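/- Let x_5 < x_4 < x_3 < y < x_2 < x_1 < x_0 be reals and let f be a real-valued function defined at all seven of these points. Set Δ_j := [x_j, x_{j-1}, x_{j-2}, x_{j-3}; f] for j = 3, 4, 5. Then Δ_4 = ((y−x_4)(x_2−x_5))/((x_2−y)(x_1−x_4))·Δ_5 − ((y−x_4)(y−x_5))/((x_2−y)(x_1−x_4))·[x_5, x_4, x_3, y; f] + ((x_1−y)(x_0−x_3))/((y−x_3)(x_1−x_4))·Δ_3 − ((x_1−y)(x_0−y))/((y−x_3)(x_1−x_4))·[y, x_2, x_1, x_0; f]. -/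

import Mathlib

/-- Third-order divided difference `[t0, t1, t2, t3; f]` at four (distinct) points. -/
noncomputable def dd4 (f : ℝ → ℝ) (t0 t1 t2 t3 : ℝ) : ℝ :=
  f t0 / ((t0 - t1) * (t0 - t2) * (t0 - t3)) +
  f t1 / ((t1 - t0) * (t1 - t2) * (t1 - t3)) +
  f t2 / ((t2 - t0) * (t2 - t1) * (t2 - t3)) +
  f t3 / ((t3 - t0) * (t3 - t1) * (t3 - t2))

/-- `f ∈ Δ³[a,b]`: `f` is continuous on `[a,b]` and all its third divided differences
over four distinct points of `[a,b]` are nonnegative (3-monotone). -/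
def Delta3 (a b : ℝ) (f : ℝ → ℝ) : Prop :=
  ContinuousOn f (Set.Icc a b) ∧
  ∀ t0 t1 t2 t3 : ℝ, t0 ∈ Set.Icc a b → t1 ∈ Set.Icc a b →
    t2 ∈ Set.Icc a b → t3 ∈ Set.Icc a b →
    t0 ≠ t1 → t0 ≠ t2 → t0 ≠ t3 → t1 ≠ t2 → t1 ≠ t3 → t2 ≠ t3 →
    0 ≤ dd4 f t0 t1 t2 t3

/-- Third divided differences are unchanged when the nodes are reversed. -/
lemma dd4_reverse (f : ℝ → ℝ) (t0 t1 t2 t3 : ℝ) :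
    dd4 f t3 t2 t1 t0 = dd4 f t0 t1 t2 t3 := by
  unfold dd4
  ring

/-- Exchanging the node `a` for a new node: both sides are differences of the second divided
differences at `b, d, c` and at `b, d, e`. -/
lemma dd4_exchange (f : ℝ → ℝ) {a b d c e : ℝ} (hab : a - b ≠ 0) (had : a - d ≠ 0)
    (hac : a - c ≠ 0) (hae : a - e ≠ 0) (hbd : b - d ≠ 0) (hbc : b - c ≠ 0) (hbe : b - e ≠ 0)
    (hdc : d - c ≠ 0) (hde : d - e ≠ 0) (hce : c - e ≠ 0) :
    (c - a) * dd4 f a b d c - (e - a) * dd4 f a b d e = (c - e) * dd4 f b d e c := by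
  unfold dd4
  rw [← neg_sub a b, ← neg_sub a d, ← neg_sub a c, ← neg_sub a e, ← neg_sub b d, ← neg_sub b c,
    ← neg_sub b e, ← neg_sub d c, ← neg_sub d e, ← neg_sub c e]
  field_simp
  ring

/-- Inserting a node `y`: a third divided difference is an affine combination of the two
obtained by replacing an extreme node by `y`. -/
lemma dd4_insert (f : ℝ → ℝ) {a b c d y : ℝ} (hab : a - b ≠ 0) (hac : a - c ≠ 0)
    (had : a - d ≠ 0) (hay : a - y ≠ 0) (hbc : b - c ≠ 0) (hbd : b - d ≠ 0) (hby : b - y ≠ 0)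
    (hcd : c - d ≠ 0) (hcy : c - y ≠ 0) (hdy : d - y ≠ 0) :
    (d - a) * dd4 f a b c d = (y - a) * dd4 f a b y c + (d - y) * dd4 f d c y b := by
  unfold dd4
  rw [← neg_sub a b, ← neg_sub a c, ← neg_sub a d, ← neg_sub a y, ← neg_sub b c, ← neg_sub b d,
    ← neg_sub b y, ← neg_sub c d, ← neg_sub c y, ← neg_sub d y]
  field_simp
  ring

/-- Identity (11): representation of `Δ₄` through `Δ₅`, `Δ₃` and the divided
differences involving an intermediate point `y ∈ (x₃, x₂)`. -/
theorem statement5 (x0 x1 x2 x3 x4 x5 y : ℝ)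
    (h54 : x5 < x4) (h43 : x4 < x3) (h3y : x3 < y) (hy2 : y < x2)
    (h21 : x2 < x1) (h10 : x1 < x0) (f : ℝ → ℝ) :
    dd4 f x4 x3 x2 x1 =
      ((y - x4) * (x2 - x5)) / ((x2 - y) * (x1 - x4)) * dd4 f x5 x4 x3 x2 -
      ((y - x4) * (y - x5)) / ((x2 - y) * (x1 - x4)) * dd4 f x5 x4 x3 y +
      ((x1 - y) * (x0 - x3)) / ((y - x3) * (x1 - x4)) * dd4 f x3 x2 x1 x0 -
      ((x1 - y) * (x0 - y)) / ((y - x3) * (x1 - x4)) * dd4 f y x2 x1 x0 := by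
  have lower := dd4_exchange f (a := x5) (b := x4) (d := x3) (c := x2) (e := y)
    (sub_ne_zero.2 (by grind)) (sub_ne_zero.2 (by grind)) (sub_ne_zero.2 (by grind)) (sub_ne_zero.2 (by grind)) (sub_ne_zero.2 (by grind))
    (sub_ne_zero.2 (by grind)) (sub_ne_zero.2 (by grind)) (sub_ne_zero.2 (by grind)) (sub_ne_zero.2 (by grind)) (sub_ne_zero.2 (by grind))
  have upper := dd4_exchange f (a := x0) (b := x1) (d := x2) (c := x3) (e := y)
    (sub_ne_zero.2 (by grind)) (sub_ne_zero.2 (by grind)) (sub_ne_zero.2 (by grind)) (sub_ne_zero.2 (by grind)) (sub_ne_zero.2 (by grind))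
    (sub_ne_zero.2 (by grind)) (sub_ne_zero.2 (by grind)) (sub_ne_zero.2 (by grind)) (sub_ne_zero.2 (by grind)) (sub_ne_zero.2 (by grind))
  have insertion := dd4_insert f (a := x4) (b := x3) (c := x2) (d := x1) (y := y)
    (sub_ne_zero.2 (by grind)) (sub_ne_zero.2 (by grind)) (sub_ne_zero.2 (by grind)) (sub_ne_zero.2 (by grind)) (sub_ne_zero.2 (by grind))
    (sub_ne_zero.2 (by grind)) (sub_ne_zero.2 (by grind)) (sub_ne_zero.2 (by grind)) (sub_ne_zero.2 (by grind)) (sub_ne_zero.2 (by grind))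
  have h2y : x2 - y ≠ 0 := sub_ne_zero.2 (by grind)
  have hy3 : y - x3 ≠ 0 := sub_ne_zero.2 (by grind)
  have h14 : x1 - x4 ≠ 0 := sub_ne_zero.2 (by grind)
  rw [← dd4_reverse f x3 x2 x1 x0, ← dd4_reverse f y x2 x1 x0]
  field_simp
  linear_combination (x2 - y) * (y - x3) * insertion - (y - x4) * (y - x3) * lower
    + (x1 - y) * (x2 - y) * upper
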